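/- arXiv:1009.0151 — 14 statements merged into one kernel-verified Lean document; each statement's English description precedes it below -/
import Mathlib

section
/- Let (Π, Ω, Z₁,…,Z_r, c₁,…,c_r) be a linear dual pair of co-rank r on a real vector space V. Then for all α, β ∈ V*, (Ω(Πα))(Πβ) = α(Πβ). (This is the paper's claim that even in the degenerate case the bracket {F,G}^Ω := Ω(X_F, X_G) defined by any dual presymplectic form Ω coincides with the Poisson bracket {F,G}_Π := ⟨dF, ΠdG⟩.) -/
/-- A linear dual pair (dual Poisson-presymplectic pair) of co-rank `r`
on a real vector space `V`. -/
structure IsLinearDualPair {V : Type*} [AddCommGroup V] [Module ℝ V] (r : ℕ)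
    (P : Module.Dual ℝ V →ₗ[ℝ] V) (O : V →ₗ[ℝ] Module.Dual ℝ V)
    (Z : Fin r → V) (c : Fin r → Module.Dual ℝ V) : Prop where
  skewP : ∀ α β : Module.Dual ℝ V, α (P β) = - β (P α)
  skewO : ∀ v w : V, O v w = - O w v
  Pc : ∀ i, P (c i) = 0
  OZ : ∀ i, O (Z i) = 0
  cZ : ∀ i j, c j (Z i) = if i = j then 1 else 0
  pou_vec : ∀ v : V, v = P (O v) + ∑ i, c i v • Z i
  pou_form : ∀ α : Module.Dual ℝ V, α = O (P α) + ∑ i, α (Z i) • c i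


/-- The bracket defined by any dual presymplectic form coincides with the Poisson
bracket: `Ω(X_F, X_G) = ⟨dF, Π dG⟩`. -/
theorem stmt1 {V : Type*} [AddCommGroup V] [Module ℝ V] {r : ℕ}
    (P : Module.Dual ℝ V →ₗ[ℝ] V) (O : V →ₗ[ℝ] Module.Dual ℝ V)
    (Z : Fin r → V) (c : Fin r → Module.Dual ℝ V)
    (h : IsLinearDualPair r P O Z c) :
    ∀ α β : Module.Dual ℝ V, (O (P α)) (P β) = α (P β) := by
  intro α β
  have hc : ∀ i, c i (P β) = 0 := fun i => by
    rw [h.skewP, h.Pc, map_zero, neg_zero]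
  have key := congrArg (fun γ : Module.Dual ℝ V => γ (P β)) (h.pou_form α)
  simp only [LinearMap.add_apply, LinearMap.sum_apply, LinearMap.smul_apply, hc, smul_zero,
    Finset.sum_const_zero, add_zero] at key
  exact key.symm
end

section
/- (Gauge freedom for the presymplectic form; linear core of the paper's Lemma 1.) Let (Π, Ω, Z₁,…,Z_r, c₁,…,c_r) be a linear dual pair of co-rank r on a real vector space V. Let f₁,…,f_r ∈ V* and define Ω′ : V → V* by Ω′v = Ωv + Σ_{i=1}^{r} (c_i(v)f_i − f_i(v)c_i), and Z′_i = Z_i − Πf_i for i = 1,…,r. Assume the gauge condition f_j(Z_i) − f_i(Z_j) + f_i(Πf_j) = 0 for all i, j (the pointwise form of Z_i(f_j) − Z_j(f_i) + Π(df_i, df_j) = 0). Then (Π, Ω′, Z′₁,…,Z′_r, c₁,…,c_r) is again a linear dual pair of co-rank r; in particular Ω′ is skew-symmetric, Ω′Z′_i = 0, c_j(Z′_i) = δ_ij, and the partition-of-unity identities hold for (Π, Ω′) with the vectors Z′_i and covectors c_i. -/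
/-- Gauge freedom for the presymplectic form (linear core of Lemma 1). -/
theorem stmt2 {V : Type*} [AddCommGroup V] [Module ℝ V] {r : ℕ}
    (P : Module.Dual ℝ V →ₗ[ℝ] V) (O : V →ₗ[ℝ] Module.Dual ℝ V)
    (Z : Fin r → V) (c : Fin r → Module.Dual ℝ V)
    (h : IsLinearDualPair r P O Z c)
    (f : Fin r → Module.Dual ℝ V)
    (O' : V →ₗ[ℝ] Module.Dual ℝ V)
    (hO' : ∀ v : V, O' v = O v + ∑ i, (c i v • f i - f i v • c i))
    (Z' : Fin r → V) (hZ' : ∀ i, Z' i = Z i - P (f i))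
    (gauge : ∀ i j, f j (Z i) - f i (Z j) + f i (P (f j)) = 0) :
    IsLinearDualPair r P O' Z' c := by
  have hcP : ∀ i α, c i (P α) = 0 := fun i α => by
    rw [h.skewP, h.Pc]; simp
  have hcZ' : ∀ i j, c j (Z' i) = if i = j then 1 else 0 := fun i j => by
    rw [hZ', map_sub, hcP, h.cZ, sub_zero]
  refine ⟨h.skewP, ?_, h.Pc, ?_, hcZ', ?_, ?_⟩
  · intro v w
    rw [hO', hO']
    simp only [LinearMap.add_apply, LinearMap.sum_apply, LinearMap.sub_apply,
      LinearMap.smul_apply, smul_eq_mul, neg_add, ← Finset.sum_neg_distrib]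
    rw [h.skewO v w]
    congr 1
    exact Finset.sum_congr rfl fun i _ => by ring
  · intro i
    have h1 : ∑ j, c j (Z' i) • f j = f i := by
      simp [hcZ']
    have h2 : ∑ j, f j (Z' i) • c j = ∑ j, f i (Z j) • c j := by
      refine Finset.sum_congr rfl fun j _ => ?_
      congr 1
      rw [hZ', map_sub]
      linarith [gauge i j, h.skewP (f i) (f j)]
    rw [hO', Finset.sum_sub_distrib, h1, h2, hZ', map_sub, h.OZ]
    nth_rewrite 2 [h.pou_form (f i)]
    abel
  · intro v
    have h1 : P (O' v) = P (O v) + ∑ i, c i v • P (f i) := by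
      rw [hO']
      simp [map_sum, h.Pc]
    rw [h1]
    simp only [hZ', smul_sub, Finset.sum_sub_distrib]
    nth_rewrite 1 [h.pou_vec v]
    abel
  · intro α
    rw [hO']
    nth_rewrite 1 [h.pou_form α]
    rw [add_assoc, ← Finset.sum_add_distrib]
    congr 1
    refine Finset.sum_congr rfl fun i _ => ?_
    rw [hcP, hZ', map_sub, h.skewP (f i) α]
    module
end

section
/- (Gauge freedom for the Poisson tensor; linear core of the paper's Lemma 2.) Let (Π, Ω, Z₁,…,Z_r, c₁,…,c_r) be a linear dual pair of co-rank r on a real vector space V. Let f₁,…,f_r ∈ V* and set K_i := Πf_i; assume Ω(K_i) = f_i, f_i(Z_j) = 0, c_i(K_j) = 0, and f_i(K_j) = 0 (i.e. Ω(K_j, K_i) = 0) for all i, j. Define Π′ : V* → V by Π′α = Πα + Σ_{i=1}^{r} (α(K_i)Z_i − α(Z_i)K_i), and c′_i := c_i + f_i. Then (Π′, Ω, Z₁,…,Z_r, c′₁,…,c′_r) is again a linear dual pair of co-rank r; in particular Π′ is skew-symmetric, Π′c′_i = 0, c′_j(Z_i) = δ_ij, and the partition-of-unity identities hold for (Π′,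 Ω) with the vectors Z_i and covectors c′_i. -/
/-- Gauge freedom for the Poisson tensor (linear core of Lemma 2). -/
theorem stmt3 {V : Type*} [AddCommGroup V] [Module ℝ V] {r : ℕ}
    (P : Module.Dual ℝ V →ₗ[ℝ] V) (O : V →ₗ[ℝ] Module.Dual ℝ V)
    (Z : Fin r → V) (c : Fin r → Module.Dual ℝ V)
    (h : IsLinearDualPair r P O Z c)
    (f : Fin r → Module.Dual ℝ V)
    (K : Fin r → V) (hK : ∀ i, K i = P (f i))
    (hOK : ∀ i, O (K i) = f i)
    (hfZ : ∀ i j, f i (Z j) = 0)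
    (hcK : ∀ i j, c i (K j) = 0)
    (hfK : ∀ i j, f i (K j) = 0)
    (P' : Module.Dual ℝ V →ₗ[ℝ] V)
    (hP' : ∀ α : Module.Dual ℝ V, P' α = P α + ∑ i, (α (K i) • Z i - α (Z i) • K i))
    (c' : Fin r → Module.Dual ℝ V) (hc' : ∀ i, c' i = c i + f i) :
    IsLinearDualPair r P' O Z c' := by
  have hOvZ : ∀ v i, O v (Z i) = 0 := fun v i => by
    rw [h.skewO, h.OZ]; simp
  have hOvK : ∀ v i, O v (K i) = - f i v := fun v i => by
    rw [h.skewO, hOK]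
  refine ⟨?_, h.skewO, ?_, h.OZ, ?_, ?_, ?_⟩
  · intro α β
    rw [hP', hP', map_add, map_add, h.skewP α β, neg_add, map_sum, map_sum,
      ← Finset.sum_neg_distrib]
    congr 1
    refine Finset.sum_congr rfl fun i _ => ?_
    simp only [map_sub, map_smul, smul_eq_mul]
    ring
  · intro i
    rw [hP', hc', map_add, h.Pc, ← hK]
    simp [hcK, hfK, hfZ, h.cZ]
  · intro i j
    rw [hc', LinearMap.add_apply, h.cZ, hfZ, add_zero]
  · intro v
    rw [hP', add_assoc, ← Finset.sum_add_distrib]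
    refine (h.pou_vec v).trans ?_
    congr 1
    refine Finset.sum_congr rfl fun i _ => ?_
    rw [hOvK, hOvZ, hc', LinearMap.add_apply]
    module
  · intro α
    rw [hP', map_add, map_sum, add_assoc, ← Finset.sum_add_distrib]
    refine (h.pou_form α).trans ?_
    congr 1
    refine Finset.sum_congr rfl fun i _ => ?_
    rw [map_sub, map_smul, map_smul, h.OZ, hOK, hc']
    module
end

section
/- (Sandwich formula from the proof of Theorem 1(ii).) Let (Π₀, Ω₀, Y₀^{(1)},…,Y₀^{(r)}, η₀^{(1)},…,η₀^{(r)}) be a linear dual pair of co-rank r on a real vector space V, and let Ω₁ : V → V* be any skew-symmetric linear map. Then for every v ∈ V: (Ω₀∘Π₀∘Ω₁∘Π₀∘Ω₀)(v) = Ω₁v − Σ_{m=1}^{r} (Ω₁v)(Y₀^{(m)}) η₀^{(m)} − Σ_{k=1}^{r} η₀^{(k)}(v) Ω₁Y₀^{(k)} + Σ_{k,m=1}^{r} η₀^{(k)}(v) (Ω₁Y₀^{(k)})(Y₀^{(m)}) η₀^{(m)}. (This is the expanded form of the paper's identity Ω₀Π₁Ω₀ = Ω₁ + Σ_k dH₀^{(k)}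 ∧ Ω₁(Y₀^{(k)}) + (1/2)Σ_{k,m} Ω₁(Y₀^{(m)},Y₀^{(k)}) dH₀^{(k)} ∧ dH₀^{(m)} for Π₁ = Π₀Ω₁Π₀.) -/
/-- Sandwich formula from the proof of Theorem 1(ii):
`Ω₀Π₀Ω₁Π₀Ω₀ = Ω₁ + Σ_k dH₀⁽ᵏ⁾ ∧ Ω₁(Y₀⁽ᵏ⁾) + (1/2)Σ_{k,m} Ω₁(Y₀⁽ᵐ⁾,Y₀⁽ᵏ⁾) dH₀⁽ᵏ⁾ ∧ dH₀⁽ᵐ⁾`,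
in expanded pointwise form. -/
theorem stmt4 {V : Type*} [AddCommGroup V] [Module ℝ V] {r : ℕ}
    (P0 : Module.Dual ℝ V →ₗ[ℝ] V) (O0 : V →ₗ[ℝ] Module.Dual ℝ V)
    (Y0 : Fin r → V) (η0 : Fin r → Module.Dual ℝ V)
    (h : IsLinearDualPair r P0 O0 Y0 η0)
    (O1 : V →ₗ[ℝ] Module.Dual ℝ V)
    (hO1skew : ∀ v w : V, O1 v w = - O1 w v) :
    ∀ v : V,
      O0 (P0 (O1 (P0 (O0 v)))) =
        O1 v - ∑ m, (O1 v) (Y0 m) • η0 m - ∑ k, η0 k v • O1 (Y0 k)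
          + ∑ k, ∑ m, (η0 k v * (O1 (Y0 k)) (Y0 m)) • η0 m := by
  intro v
  have h1 : P0 (O0 v) = v - ∑ k, η0 k v • Y0 k := eq_sub_of_add_eq (h.pou_vec v).symm
  have h2 : ∀ α : Module.Dual ℝ V, O0 (P0 α) = α - ∑ m, α (Y0 m) • η0 m :=
    fun α => eq_sub_of_add_eq (h.pou_form α).symm
  have h3 : O1 (P0 (O0 v)) = O1 v - ∑ k, η0 k v • O1 (Y0 k) := by
    rw [h1, map_sub, map_sum]
    simp only [map_smul]
  have h4 : ∀ k, O0 (P0 (η0 k v • O1 (Y0 k))) =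
      η0 k v • O1 (Y0 k) - ∑ m, (η0 k v * (O1 (Y0 k)) (Y0 m)) • η0 m := by
    intro k
    rw [h2]
    simp only [LinearMap.smul_apply, smul_eq_mul]
  rw [h3, map_sub, map_sub, map_sum, map_sum, h2, Finset.sum_congr rfl (fun k _ => h4 k),
    Finset.sum_sub_distrib]
  abel
end

section
/- (Algebraic content of Theorem 1(ii).) Let (Π₀, Ω₀, Y₀^{(1)},…,Y₀^{(r)}, η₀^{(1)},…,η₀^{(r)}) be a linear dual pair of co-rank r on a real vector space V, and let Ω₁ : V → V* be a skew-symmetric linear map. Assume there exist covectors F^{(1)},…,F^{(r)} ∈ V* such that Π₀(Ω₁Y₀^{(k)}) = Π₀F^{(k)} for every k = 1,…,r. Then for every v ∈ V: (Ω₀∘Π₀∘Ω₁∘Π₀∘Ω₀)(v) = Ω₁v + Σ_{k=1}^{r} (F^{(k)}(v) η₀^{(k)} − η₀^{(k)}(v) F^{(k)}) + Σ_{k,m=1}^{r} [ (Ω₁Y₀^{(m)})(Y₀^{(k)}) + F^{(k)}(Y₀^{(m)}) − F^{(m)}(Y₀^{(k)}) ] η₀^{(k)}(v) η₀^{(m)}.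 In particular, if (Ω₁Y₀^{(k)})(Y₀^{(m)}) + F^{(m)}(Y₀^{(k)}) − F^{(k)}(Y₀^{(m)}) = 0 for all k, m, then Ω₀∘Π₀∘Ω₁∘Π₀∘Ω₀ differs from Ω₁ exactly by Σ_{k} (F^{(k)}(·) η₀^{(k)} − η₀^{(k)}(·) F^{(k)}). -/
/-- Algebraic content of Theorem 1(ii). -/
theorem stmt5 {V : Type*} [AddCommGroup V] [Module ℝ V] {r : ℕ}
    (P0 : Module.Dual ℝ V →ₗ[ℝ] V) (O0 : V →ₗ[ℝ] Module.Dual ℝ V)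
    (Y0 : Fin r → V) (η0 : Fin r → Module.Dual ℝ V)
    (h : IsLinearDualPair r P0 O0 Y0 η0)
    (O1 : V →ₗ[ℝ] Module.Dual ℝ V)
    (hO1skew : ∀ v w : V, O1 v w = - O1 w v)
    (F : Fin r → Module.Dual ℝ V)
    (hF : ∀ k, P0 (O1 (Y0 k)) = P0 (F k)) :
    (∀ v : V,
      O0 (P0 (O1 (P0 (O0 v)))) =
        O1 v + ∑ k, (F k v • η0 k - η0 k v • F k)
          + ∑ k, ∑ m,
              (((O1 (Y0 m)) (Y0 k) + F k (Y0 m) - F m (Y0 k)) * η0 k v) • η0 m) ∧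
    ((∀ k m, (O1 (Y0 k)) (Y0 m) + F m (Y0 k) - F k (Y0 m) = 0) →
      ∀ v : V,
        O0 (P0 (O1 (P0 (O0 v)))) = O1 v + ∑ k, (F k v • η0 k - η0 k v • F k)) := by
  have main : ∀ v : V,
      O0 (P0 (O1 (P0 (O0 v)))) =
        O1 v + ∑ k, (F k v • η0 k - η0 k v • F k)
          + ∑ k, ∑ m,
              (((O1 (Y0 m)) (Y0 k) + F k (Y0 m) - F m (Y0 k)) * η0 k v) • η0 m := by
    intro v
    have hw : P0 (O0 v) = v - ∑ i, η0 i v • Y0 i := eq_sub_of_add_eq (h.pou_vec v).symm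
    have hOP : ∀ α : Module.Dual ℝ V, O0 (P0 α) = α - ∑ i, α (Y0 i) • η0 i :=
      fun α => eq_sub_of_add_eq (h.pou_form α).symm
    have hY : ∀ m, O1 v (Y0 m) =
        - (F m v + ∑ k, ((O1 (Y0 m)) (Y0 k) - F m (Y0 k)) * η0 k v) := by
      intro m
      have e : O0 (P0 (O1 (Y0 m))) = O0 (P0 (F m)) := by rw [hF]
      rw [hOP, hOP] at e
      have e2 := congrArg (fun α : Module.Dual ℝ V => α v) e
      simp only [LinearMap.sub_apply, LinearMap.sum_apply, LinearMap.smul_apply,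
        smul_eq_mul] at e2
      rw [hO1skew v (Y0 m)]
      simp only [sub_mul, Finset.sum_sub_distrib]
      linarith
    have e1 : O0 (P0 (O1 (P0 (O0 v)))) =
        O0 (P0 (O1 v)) - ∑ k, η0 k v • O0 (P0 (F k)) := by
      rw [hw]
      simp only [map_sub, map_sum, map_smul, hF]
    rw [e1, Finset.sum_comm (γ := Fin r)]
    simp only [hOP]
    ext x
    simp only [hY, LinearMap.sub_apply, LinearMap.add_apply, LinearMap.sum_apply,
      LinearMap.smul_apply, smul_eq_mul, add_mul, sub_mul, neg_mul, mul_sub, Finset.sum_add_distrib,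
      Finset.sum_sub_distrib, Finset.sum_neg_distrib, Finset.sum_mul, Finset.mul_sum]
    have e3 : ∑ k, ∑ m, η0 k v * (F k (Y0 m) * η0 m x)
        = ∑ m, ∑ k, F k (Y0 m) * η0 k v * η0 m x := by
      rw [Finset.sum_comm]
      refine Finset.sum_congr rfl fun _ _ => Finset.sum_congr rfl fun _ _ => by ring
    rw [e3]
    ring
  refine ⟨main, fun h0 v => ?_⟩
  rw [main v]
  simp [h0]
end

section
/- (Theorem 3(i): isotropy of bi-presymplectic chains.) Let V be a real vector space and let Ω₀, Ω₁ : V → V* be skew-symmetric linear maps (i.e. (Ωv)(w) = −(Ωw)(v)). For k = 1,…,r let n_k ≥ 1 and let Y₀^{(k)}, Y₁^{(k)}, …, Y_{n_k}^{(k)} ∈ V satisfy the chain conditions: Ω₀Y₀^{(k)} = 0, Ω₀Y_i^{(k)} = Ω₁Y_{i−1}^{(k)} for i = 1,…,n_k, and Ω₁Y_{n_k}^{(k)} = 0. Then for all k, m ∈ {1,…,r}, all 0 ≤ i ≤ n_k and all 0 ≤ j ≤ n_m: (Ω₀Y_i^{(k)})(Y_j^{(m)}) = 0 and (Ω₁Y_i^{(k)})(Y_j^{(m)})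 = 0. -/
/-- Theorem 3(i): isotropy of bi-presymplectic chains. -/
theorem stmt6 {V : Type*} [AddCommGroup V] [Module ℝ V] {r : ℕ}
    (O0 O1 : V →ₗ[ℝ] Module.Dual ℝ V)
    (hO0skew : ∀ v w : V, O0 v w = - O0 w v)
    (hO1skew : ∀ v w : V, O1 v w = - O1 w v)
    (n : Fin r → ℕ) (hn : ∀ k, 1 ≤ n k)
    (Y : Fin r → ℕ → V)
    (hstart : ∀ k, O0 (Y k 0) = 0)
    (hchain : ∀ k, ∀ i < n k, O0 (Y k (i + 1)) = O1 (Y k i))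
    (hend : ∀ k, O1 (Y k (n k)) = 0) :
    ∀ k m : Fin r, ∀ i ≤ n k, ∀ j ≤ n m,
      (O0 (Y k i)) (Y m j) = 0 ∧ (O1 (Y k i)) (Y m j) = 0 := by
  have key : ∀ k m : Fin r, ∀ i, i ≤ n k → ∀ j ≤ n m, (O0 (Y k i)) (Y m j) = 0 := by
    intro k m i
    induction i with
    | zero => intro _ j _; simp [hstart k]
    | succ i ih =>
      intro hi j hj
      rw [hchain k i (by omega), hO1skew]
      rcases Nat.lt_or_ge j (n m) with h | h
      · rw [← hchain m j h, ← hO0skew]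
        exact ih (by omega) (j + 1) h
      · have hjn : j = n m := by omega
        rw [hjn, hend m]
        simp
  intro k m i hi j hj
  refine ⟨key k m i hi j hj, ?_⟩
  rcases Nat.lt_or_ge i (n k) with h | h
  · rw [← hchain k i h]
    exact key k m (i + 1) h j hj
  · have hin : i = n k := by omega
    rw [hin, hend k]
    simp
end

section
/- (Theorem 3(ii): involutivity.) Let (Π₀, Ω₀, Y₀^{(1)},…,Y₀^{(r)}, η₀^{(1)},…,η₀^{(r)}) be a linear dual pair of co-rank r on a real vector space V, let Ω₁ : V → V* be a skew-symmetric linear map, and for k = 1,…,r let Y₀^{(k)}, Y₁^{(k)}, …, Y_{n_k}^{(k)} ∈ V form a bi-presymplectic chain for (Ω₀, Ω₁), i.e. Ω₀Y₀^{(k)} = 0, Ω₀Y_i^{(k)} = Ω₁Y_{i−1}^{(k)} for i = 1,…,n_k, and Ω₁Y_{n_k}^{(k)} = 0. Assume there exist covectors η_i^{(k)} ∈ V* (k = 1,…,r, i = 1,…,n_k) such that Π₀(Ω₀Y_i^{(k)}) = Π₀η_i^{(k)}. Then η_i^{(k)}(Π₀η_j^{(m)}) = 0 for all k, m ∈ {1,…,r},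 1 ≤ i ≤ n_k, 1 ≤ j ≤ n_m (the Hamiltonians H_i^{(k)} are in involution with respect to Π₀). -/
/-- Theorem 3(ii): involutivity of the Hamiltonians of a bi-presymplectic chain. -/
theorem stmt7 {V : Type*} [AddCommGroup V] [Module ℝ V] {r : ℕ}
    (P0 : Module.Dual ℝ V →ₗ[ℝ] V) (O0 O1 : V →ₗ[ℝ] Module.Dual ℝ V)
    (n : Fin r → ℕ) (hn : ∀ k, 1 ≤ n k)
    (Y : Fin r → ℕ → V) (η : Fin r → ℕ → Module.Dual ℝ V)
    (h : IsLinearDualPair r P0 O0 (fun k => Y k 0) (fun k => η k 0))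
    (hO1skew : ∀ v w : V, O1 v w = - O1 w v)
    (hchain : ∀ k, ∀ i < n k, O0 (Y k (i + 1)) = O1 (Y k i))
    (hend : ∀ k, O1 (Y k (n k)) = 0)
    (hη : ∀ k, ∀ i, 1 ≤ i → i ≤ n k → P0 (O0 (Y k i)) = P0 (η k i)) :
    ∀ k m : Fin r, ∀ i, 1 ≤ i → i ≤ n k → ∀ j, 1 ≤ j → j ≤ n m →
      η k i (P0 (η m j)) = 0 := by
  have key : ∀ k m : Fin r, ∀ i, i ≤ n k → ∀ j, j ≤ n m → O0 (Y k i) (Y m j) = 0 := by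
    intro k m i
    induction i with
    | zero =>
      intro _ j _
      have h0 : O0 (Y k 0) = 0 := h.OZ k
      rw [h0]; rfl
    | succ i ih =>
      intro hi j hj
      rw [hchain k i (by omega), hO1skew]
      rcases Nat.lt_or_ge j (n m) with hlt | hge
      · rw [← hchain m j hlt, h.skewO, neg_neg]
        exact ih (by omega) (j + 1) hlt
      · have hjn : j = n m := le_antisymm hj hge
        rw [hjn, hend m]; simp
  intro k m i hi hik j hj hjm
  rw [← hη m j hj hjm, h.skewP, ← hη k i hi hik]
  have e := congrArg (O0 (Y m j)) (h.pou_vec (Y k i))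
  have hz : ∀ l, O0 (Y m j) (Y l 0) = 0 := by
    intro l
    exact key m l j hjm 0 (Nat.zero_le _)
  rw [key m k j hjm i hik] at e
  simp only [map_add, map_sum, map_smul, hz, smul_zero, Finset.sum_const_zero, add_zero] at e
  rw [← e, neg_zero]
end

section
/- (Theorem 3(iii), algebraic part: the bi-Hamiltonian chain.) Let (Π₀, Ω₀, Y₀^{(1)},…,Y₀^{(r)}, η₀^{(1)},…,η₀^{(r)}) be a linear dual pair of co-rank r on a real vector space V, let Ω₁ : V → V* be skew-symmetric, and for k = 1,…,r let Y₀^{(k)},…,Y_{n_k}^{(k)} ∈ V form a bi-presymplectic chain for (Ω₀, Ω₁): Ω₀Y₀^{(k)} = 0, Ω₀Y_i^{(k)} = Ω₁Y_{i−1}^{(k)} (i = 1,…,n_k), Ω₁Y_{n_k}^{(k)} = 0. Assume there are covectors η_i^{(k)} ∈ V* with X_i^{(k)} := Π₀(Ω₀Y_i^{(k)}) = Π₀η_i^{(k)} for all k and i = 1,…,n_k, and assume condition (4.5): η_i^{(m)}(Y₀^{(k)}) = η₀^{(k)}(Y_i^{(m)}) for all k, m and i = 1,…,n_m. Define Π₁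 : V* → V by Π₁α := Π₀(Ω₁(Π₀α)) + Σ_{m=1}^{r} ( α(Y₀^{(m)}) X₁^{(m)} − α(X₁^{(m)}) Y₀^{(m)} ). Then Π₁η₀^{(k)} = X₁^{(k)}, Π₁η_{i−1}^{(k)} = X_i^{(k)} for i = 2,…,n_k, and Π₁η_{n_k}^{(k)} = 0; i.e. the Hamiltonian vector fields form bi-Hamiltonian chains starting from the Casimir covectors η₀^{(k)} of Π₀ and terminating with η_{n_k}^{(k)} in the kernel of Π₁. -/
/-- Theorem 3(iii), algebraic part: the bi-Hamiltonian chain. -/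
theorem stmt9 {V : Type*} [AddCommGroup V] [Module ℝ V] {r : ℕ}
    (P0 : Module.Dual ℝ V →ₗ[ℝ] V) (O0 O1 : V →ₗ[ℝ] Module.Dual ℝ V)
    (n : Fin r → ℕ) (hn : ∀ k, 1 ≤ n k)
    (Y : Fin r → ℕ → V) (η : Fin r → ℕ → Module.Dual ℝ V)
    (h : IsLinearDualPair r P0 O0 (fun k => Y k 0) (fun k => η k 0))
    (hO1skew : ∀ v w : V, O1 v w = - O1 w v)
    (hchain : ∀ k, ∀ i < n k, O0 (Y k (i + 1)) = O1 (Y k i))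
    (hend : ∀ k, O1 (Y k (n k)) = 0)
    (hη : ∀ k, ∀ i, 1 ≤ i → i ≤ n k → P0 (O0 (Y k i)) = P0 (η k i))
    (h45 : ∀ k m : Fin r, ∀ i, 1 ≤ i → i ≤ n m → η m i (Y k 0) = η k 0 (Y m i))
    (P1 : Module.Dual ℝ V →ₗ[ℝ] V)
    (hP1 : ∀ α : Module.Dual ℝ V,
      P1 α = P0 (O1 (P0 α))
        + ∑ m, (α (Y m 0) • P0 (η m 1) - α (P0 (η m 1)) • Y m 0)) :
    (∀ k, ∀ i, 1 ≤ i → i ≤ n k → P1 (η k (i - 1)) = P0 (η k i)) ∧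
    (∀ k, P1 (η k (n k)) = 0) := by
  have hX1 : ∀ m, P0 (O1 (Y m 0)) = P0 (η m 1) := by
    intro m
    rw [← hchain m 0 (hn m)]
    exact hη m 1 le_rfl (hn m)
  have hO1Y : ∀ k i, i ≤ n k → ∀ m, O1 (Y k i) (Y m 0) = 0 := by
    intro k i hi m
    rcases hi.lt_or_eq with hlt | heq
    · rw [← hchain k i hlt, h.skewO]
      have := h.OZ m
      simp [this]
    · rw [heq, hend]; rfl
  have hPη : ∀ k i, 1 ≤ i → i ≤ n k →
      P0 (η k i) = Y k i - ∑ m, η m 0 (Y k i) • Y m 0 := by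
    intro k i h1 h2
    rw [← hη k i h1 h2]
    exact eq_sub_of_add_eq (h.pou_vec (Y k i)).symm
  have hzero : ∀ k i, 1 ≤ i → i ≤ n k → ∀ m, η k i (P0 (η m 1)) = 0 := by
    intro k i h1 h2 m
    have hz : ∀ l, O0 (Y m 1) (Y l 0) = 0 := by
      intro l
      have := h.OZ l
      rw [h.skewO, this]; simp
    have e : O0 (Y m 1) (Y k i) = 0 := by
      rw [hchain m 0 (hn m), hO1skew, hO1Y k i h2 m, neg_zero]
    rw [← hη m 1 le_rfl (hn m), h.skewP, hPη k i h1 h2]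
    simp [hz, e]
  have key : ∀ k i, 1 ≤ i → i ≤ n k → P1 (η k i) = P0 (O1 (Y k i)) := by
    intro k i h1 h2
    rw [hP1]
    simp only [hzero k i h1 h2, h45 _ k i h1 h2, zero_smul, sub_zero]
    rw [hPη k i h1 h2]
    simp only [map_sub, map_sum, map_smul, hX1]
    abel
  refine ⟨?_, ?_⟩
  · intro k i h1 h2
    obtain ⟨j, rfl⟩ : ∃ j, i = j + 1 := ⟨i - 1, by omega⟩
    rw [Nat.add_sub_cancel]
    rcases Nat.eq_zero_or_pos j with rfl | hj
    · have hP := h.Pc k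
      have hc : ∀ m, η k 0 (Y m 0) = if m = k then 1 else 0 := fun m => h.cZ m k
      have hz : ∀ m, η k 0 (P0 (η m 1)) = 0 := by
        intro m
        rw [h.skewP, hP]; simp
      rw [hP1, hP]
      simp [hc, hz]
    · rw [key k j hj (by omega), ← hchain k j (by omega)]
      exact hη k (j + 1) h1 h2
  · intro k
    rw [key k (n k) (hn k) le_rfl, hend, map_zero]
end

section
/- (Quasi-bi-Hamiltonian representation, equation (4.9).) Let (Π₀, Ω₀, Y₀^{(1)},…,Y₀^{(r)}, η₀^{(1)},…,η₀^{(r)}) be a linear dual pair of co-rank r on a real vector space V, let Ω₁ : V → V* be skew-symmetric, and for k = 1,…,r let Y₀^{(k)},…,Y_{n_k}^{(k)} ∈ V satisfy Ω₀Y₀^{(k)} = 0 and Ω₀Y_i^{(k)} = Ω₁Y_{i−1}^{(k)} for i = 1,…,n_k. Assume there are covectors η_i^{(k)} ∈ V* with Π₀(Ω₀Y_i^{(k)}) = Π₀η_i^{(k)} for all k and i = 1,…,n_k. Then for every k and every i = 1,…,n_k (reading η₀^{(k)} for i−1 = 0): Π₀(Ω₁(Π₀η_{i−1}^{(k)}))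 = Π₀η_i^{(k)} − Σ_{m=1}^{r} η₀^{(m)}(Y_{i−1}^{(k)}) · Π₀η₁^{(m)}; i.e., with Π₁ := Π₀Ω₁Π₀ and F_{i−1}^{(k,m)} := −η₀^{(m)}(Y_{i−1}^{(k)}), one has Π₁ dH_{i−1}^{(k)} = Π₀ dH_i^{(k)} + Σ_m F_{i−1}^{(k,m)} Π₀ dH₁^{(m)}. -/
/-- Quasi-bi-Hamiltonian representation, equation (4.9):
`Π₁ dH_{i-1} = Π₀ dH_i + Σ_m F_{i-1}^{(k,m)} Π₀ dH₁^{(m)}` with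
`Π₁ = Π₀Ω₁Π₀` and `F_{i-1}^{(k,m)} = -η₀^{(m)}(Y_{i-1}^{(k)})`. -/
theorem stmt10 {V : Type*} [AddCommGroup V] [Module ℝ V] {r : ℕ}
    (P0 : Module.Dual ℝ V →ₗ[ℝ] V) (O0 O1 : V →ₗ[ℝ] Module.Dual ℝ V)
    (n : Fin r → ℕ) (hn : ∀ k, 1 ≤ n k)
    (Y : Fin r → ℕ → V) (η : Fin r → ℕ → Module.Dual ℝ V)
    (h : IsLinearDualPair r P0 O0 (fun k => Y k 0) (fun k => η k 0))
    (hO1skew : ∀ v w : V, O1 v w = - O1 w v)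
    (hchain : ∀ k, ∀ i < n k, O0 (Y k (i + 1)) = O1 (Y k i))
    (hη : ∀ k, ∀ i, 1 ≤ i → i ≤ n k → P0 (O0 (Y k i)) = P0 (η k i)) :
    ∀ k, ∀ i < n k,
      P0 (O1 (P0 (η k i))) =
        P0 (η k (i + 1)) - ∑ m, η m 0 (Y k i) • P0 (η m 1) := by
  intro k i hi
  have h1 : P0 (η k i) = P0 (O0 (Y k i)) := by
    rcases Nat.eq_zero_or_pos i with rfl | hp
    · have a : P0 (η k 0) = 0 := h.Pc k
      have b : O0 (Y k 0) = 0 := h.OZ k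
      rw [a, b, map_zero]
    · exact (hη k i hp hi.le).symm
  have h2 : P0 (O0 (Y k i)) = Y k i - ∑ m, η m 0 (Y k i) • Y m 0 :=
    eq_sub_of_add_eq (h.pou_vec (Y k i)).symm
  rw [h1, h2, map_sub, map_sub, ← hchain k i hi, hη k (i + 1) (by omega) (by omega),
    map_sum, map_sum]
  congr 1
  refine Finset.sum_congr rfl fun m _ => ?_
  rw [map_smul, map_smul, ← hchain m 0 (hn m), hη m (0 + 1) (by omega) (hn m)]
end

section
/- (Section 6: every quasi-bi-inverse-Hamiltonian system extends to a bi-inverse-Hamiltonian chain.) Let V be a real vector space and Ω₀, Ω_{1D} : V → V* skew-symmetric linear maps. For k = 1,…,r let Y₀^{(k)} ∈ V with Ω₀Y₀^{(k)} = 0 and Ω_{1D}Y₀^{(k)} = 0, and let c₁,…,c_r ∈ V* with c_l(Y₀^{(k)}) = δ_lk. For each k let X₁^{(k)},…,X_{n_k}^{(k)} ∈ V and h₁^{(k)},…,h_{n_k}^{(k)} ∈ V* satisfy Ω₀X_i^{(k)} = h_i^{(k)}, c_l(X_i^{(k)}) = 0, h₁^{(l)}(X_i^{(k)}) = 0, and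 h₁^{(l)}(Y₀^{(k)}) = 0 for all admissible indices, together with the quasi-chain relations Ω_{1D}X_i^{(k)} = Ω₀X_{i+1}^{(k)} + Σ_{l=1}^{r} F_i^{(k,l)} Ω₀X₁^{(l)} for i = 1,…,n_k (scalars F_i^{(k,l)}, with the convention X_{n_k+1}^{(k)} := 0). Define Ω₁ : V → V* by Ω₁v := Ω_{1D}v + Σ_{k=1}^{r} ( c_k(v) h₁^{(k)} − h₁^{(k)}(v) c_k ), and Y_i^{(k)} := X_i^{(k)} − Σ_{l=1}^{r} F_i^{(k,l)} Y₀^{(l)} for i = 1,…,n_k. Then the bi-inverse-Hamiltonian chain relations hold: Ω₀Y_{i+1}^{(k)} = h_{i+1}^{(k)} = Ω₁Y_i^{(k)} for i = 0,…,n_k − 1, and Ω₁Y_{n_k}^{(k)} = 0; i.e. each chain starts with a kernel vector Y₀^{(k)} of Ω₀ and terminates with a kernel vector Y_{n_k}^{(k)} of Ω₁. -/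
/-- Section 6: every quasi-bi-inverse-Hamiltonian system extends to a
bi-inverse-Hamiltonian chain on the extended phase space. -/
theorem stmt11 {V : Type*} [AddCommGroup V] [Module ℝ V] {r : ℕ}
    (O0 O1D : V →ₗ[ℝ] Module.Dual ℝ V)
    (hO0skew : ∀ v w : V, O0 v w = - O0 w v)
    (hO1Dskew : ∀ v w : V, O1D v w = - O1D w v)
    (n : Fin r → ℕ) (hn : ∀ k, 1 ≤ n k)
    (Y0 : Fin r → V) (c : Fin r → Module.Dual ℝ V)
    (hO0Y0 : ∀ k, O0 (Y0 k) = 0)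
    (hO1DY0 : ∀ k, O1D (Y0 k) = 0)
    (hcY0 : ∀ l k, c l (Y0 k) = if l = k then 1 else 0)
    (X : Fin r → ℕ → V) (hf : Fin r → ℕ → Module.Dual ℝ V)
    (F : Fin r → ℕ → Fin r → ℝ)
    (hOX : ∀ k, ∀ i, 1 ≤ i → i ≤ n k → O0 (X k i) = hf k i)
    (hcX : ∀ l k, ∀ i, 1 ≤ i → i ≤ n k → c l (X k i) = 0)
    (hinv : ∀ l k, ∀ i, 1 ≤ i → i ≤ n k → hf l 1 (X k i) = 0)
    (hhY0 : ∀ l k, hf l 1 (Y0 k) = 0)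
    (hXtop : ∀ k, X k (n k + 1) = 0)
    (hquasi : ∀ k, ∀ i, 1 ≤ i → i ≤ n k →
      O1D (X k i) = O0 (X k (i + 1)) + ∑ l, F k i l • O0 (X l 1))
    (O1 : V →ₗ[ℝ] Module.Dual ℝ V)
    (hO1 : ∀ v : V, O1 v = O1D v + ∑ k, (c k v • hf k 1 - hf k 1 v • c k))
    (Yc : Fin r → ℕ → V)
    (hYc0 : ∀ k, Yc k 0 = Y0 k)
    (hYci : ∀ k, ∀ i, 1 ≤ i → i ≤ n k → Yc k i = X k i - ∑ l, F k i l • Y0 l) :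
    ∀ k, (∀ i < n k, O0 (Yc k (i + 1)) = hf k (i + 1) ∧ O1 (Yc k i) = hf k (i + 1))
      ∧ O1 (Yc k (n k)) = 0 := by
  have h1 : ∀ k, O1 (Y0 k) = hf k 1 := by
    intro k
    rw [hO1, hO1DY0]
    simp [hcY0, hhY0, ite_smul]
  have h2 : ∀ k i, 1 ≤ i → i ≤ n k → O1 (X k i) = O1D (X k i) := by
    intro k i hi hin
    rw [hO1, Finset.sum_eq_zero, add_zero]
    intro l _
    rw [hcX l k i hi hin, hinv l k i hi hin]
    simp
  have h3 : ∀ k i, 1 ≤ i → i ≤ n k → O1 (Yc k i) = O0 (X k (i + 1)) := by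
    intro k i hi hin
    rw [hYci k i hi hin, map_sub, h2 k i hi hin, hquasi k i hi hin, map_sum]
    have : ∑ l, O1 (F k i l • Y0 l) = ∑ l, F k i l • O0 (X l 1) := by
      refine Finset.sum_congr rfl fun l _ => ?_
      rw [map_smul, h1, hOX l 1 le_rfl (hn l)]
    rw [this, add_sub_cancel_right]
  intro k
  refine ⟨fun i hi => ⟨?_, ?_⟩, ?_⟩
  · rw [hYci k (i + 1) (by omega) (by omega), map_sub, hOX k (i + 1) (by omega) (by omega)]
    simp [hO0Y0]
  · rcases Nat.eq_zero_or_pos i with rfl | hp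
    · rw [hYc0, h1]
    · rw [h3 k i hp hi.le, hOX k (i + 1) (by omega) (by omega)]
  · rw [h3 k (n k) (hn k) le_rfl, hXtop, map_zero]
end

section
/- (Example 1: involutivity of the Benenti-type geodesic Hamiltonians.) On ℝ⁶ with coordinates (q₁,q₂,q₃,p₁,p₂,p₃), define E₁ = p₁p₃ + (1/2)p₂², E₂ = p₁p₂ + (1/2)q₁p₂² + (1/2)q₁p₁p₃ − (1/2)q₂p₂p₃ − (1/2)q₃p₃², and E₃ = (1/2)p₁² + (1/8)q₁²p₂² + (1/8)q₂²p₃² + (1/2)q₁p₁p₂ + (1/2)q₂p₁p₃ − ((1/4)q₁q₂ + q₃)p₂p₃. Then {E₁,E₂} = 0, {E₁,E₃} = 0, and {E₂,E₃} = 0 identically on ℝ⁶, where {·,·} is the canonical Poisson bracket. -/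
noncomputable section Stmt12

/-- Partial derivative in the `i`-th coordinate direction on `ℝ⁶`. -/
def pd (i : Fin 6) (F : (Fin 6 → ℝ) → ℝ) (x : Fin 6 → ℝ) : ℝ :=
  fderiv ℝ F x (Pi.single i 1)

/-- The canonical Poisson bracket on `ℝ⁶` with coordinates
`(q₁,q₂,q₃,p₁,p₂,p₃) = (x 0, x 1, x 2, x 3, x 4, x 5)`. -/
def pb (F G : (Fin 6 → ℝ) → ℝ) (x : Fin 6 → ℝ) : ℝ :=
  (pd 0 F x * pd 3 G x - pd 3 F x * pd 0 G x) +
  (pd 1 F x * pd 4 G x - pd 4 F x * pd 1 G x) +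
  (pd 2 F x * pd 5 G x - pd 5 F x * pd 2 G x)

def E1 (x : Fin 6 → ℝ) : ℝ := x 3 * x 5 + (1/2) * x 4 ^ 2

def E2 (x : Fin 6 → ℝ) : ℝ :=
  x 3 * x 4 + (1/2) * x 0 * x 4 ^ 2 + (1/2) * x 0 * x 3 * x 5
    - (1/2) * x 1 * x 4 * x 5 - (1/2) * x 2 * x 5 ^ 2

def E3 (x : Fin 6 → ℝ) : ℝ :=
  (1/2) * x 3 ^ 2 + (1/8) * x 0 ^ 2 * x 4 ^ 2 + (1/8) * x 1 ^ 2 * x 5 ^ 2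
    + (1/2) * x 0 * x 3 * x 4 + (1/2) * x 1 * x 3 * x 5
    - ((1/4) * x 0 * x 1 + x 2) * x 4 * x 5

theorem proj_hasFDerivAt (i : Fin 6) (x : Fin 6 → ℝ) :
    HasFDerivAt (fun y : Fin 6 → ℝ => y i)
      (ContinuousLinearMap.proj (R := ℝ) (φ := fun _ : Fin 6 => ℝ) i) x :=
  hasFDerivAt_apply i x

theorem pd_E1 (i : Fin 6) (x : Fin 6 → ℝ) : pd i E1 x =
    ![0, 0, 0, x 5, x 4, x 3] i := by
  have h := ((proj_hasFDerivAt 3 x).mul (proj_hasFDerivAt 5 x)).add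
    (((proj_hasFDerivAt 4 x).pow 2).const_mul (1/2))
  have hE : HasFDerivAt E1 _ x := h
  rw [pd, hE.fderiv]
  fin_cases i <;> simp

theorem pd_E2 (i : Fin 6) (x : Fin 6 → ℝ) : pd i E2 x =
    ![(1/2) * x 4 ^ 2 + (1/2) * x 3 * x 5, -(1/2) * x 4 * x 5, -(1/2) * x 5 ^ 2,
      x 4 + (1/2) * x 0 * x 5, x 3 + x 0 * x 4 - (1/2) * x 1 * x 5,
      (1/2) * x 0 * x 3 - (1/2) * x 1 * x 4 - x 2 * x 5] i := by
  have P := fun i => proj_hasFDerivAt i x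
  have hE : HasFDerivAt E2 _ x :=
    (((((P 3).mul (P 4)).add (((P 0).const_mul (1/2)).mul ((P 4).pow 2))).add
      ((((P 0).const_mul (1/2)).mul (P 3)).mul (P 5))).sub
      ((((P 1).const_mul (1/2)).mul (P 4)).mul (P 5))).sub
      (((P 2).const_mul (1/2)).mul ((P 5).pow 2))
  rw [pd, hE.fderiv]
  fin_cases i <;> simp <;> ring

theorem pd_E3 (i : Fin 6) (x : Fin 6 → ℝ) : pd i E3 x =
    ![(1/4) * x 0 * x 4 ^ 2 + (1/2) * x 3 * x 4 - (1/4) * x 1 * x 4 * x 5,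
      (1/4) * x 1 * x 5 ^ 2 + (1/2) * x 3 * x 5 - (1/4) * x 0 * x 4 * x 5,
      -(x 4 * x 5),
      x 3 + (1/2) * x 0 * x 4 + (1/2) * x 1 * x 5,
      (1/4) * x 0 ^ 2 * x 4 + (1/2) * x 0 * x 3 - ((1/4) * x 0 * x 1 + x 2) * x 5,
      (1/4) * x 1 ^ 2 * x 5 + (1/2) * x 1 * x 3 - ((1/4) * x 0 * x 1 + x 2) * x 4] i := by
  have P := fun i => proj_hasFDerivAt i x
  have hE : HasFDerivAt E3 _ x :=
    (((((((P 3).pow 2).const_mul (1/2)).add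
      ((((P 0).pow 2).const_mul (1/8)).mul ((P 4).pow 2))).add
      ((((P 1).pow 2).const_mul (1/8)).mul ((P 5).pow 2))).add
      ((((P 0).const_mul (1/2)).mul (P 3)).mul (P 4))).add
      ((((P 1).const_mul (1/2)).mul (P 3)).mul (P 5))).sub
      ((((((P 0).const_mul (1/4)).mul (P 1)).add (P 2)).mul (P 4)).mul (P 5))
  rw [pd, hE.fderiv]
  fin_cases i <;> simp <;> ring

/-- Example 1: involutivity of the Benenti-type geodesic Hamiltonians. -/
theorem stmt12 : ∀ x : Fin 6 → ℝ,
    pb E1 E2 x = 0 ∧ pb E1 E3 x = 0 ∧ pb E2 E3 x = 0 := by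
  intro x
  refine ⟨?_, ?_, ?_⟩ <;> simp only [pb, pd_E1, pd_E2, pd_E3] <;> simp <;> ring

end Stmt12
end

section
/- (Example 1: quasi-bi-inverse-Hamiltonian chain.) On ℝ⁶ with coordinates (q₁,q₂,q₃,p₁,p₂,p₃), let E₁ = p₁p₃ + (1/2)p₂², E₂ = p₁p₂ + (1/2)q₁p₂² + (1/2)q₁p₁p₃ − (1/2)q₂p₂p₃ − (1/2)q₃p₃², E₃ = (1/2)p₁² + (1/8)q₁²p₂² + (1/8)q₂²p₃² + (1/2)q₁p₁p₂ + (1/2)q₂p₁p₃ − ((1/4)q₁q₂ + q₃)p₂p₃, and let x_i := π₀∇E_i. Let ω₁ be the 6×6 matrix-valued function with rows (0, (1/2)p₂, (1/2)p₃, (1/2)q₁, (1/2)q₂, q₃), (−(1/2)p₂, 0, 0, −1, 0, (1/2)q₂), (−(1/2)p₃, 0, 0, 0, −1, (1/2)q₁), (−(1/2)q₁, 1, 0, 0, 0, 0), (−(1/2)q₂, 0, 1, 0, 0, 0), (−q₃, −(1/2)q₂, −(1/2)q₁, 0, 0, 0). Then at every point of ℝ⁶: ω₁x₁ = ∇E₂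 − q₁∇E₁, ω₁x₂ = ∇E₃ − ((1/4)q₁² + q₂)∇E₁, and ω₁x₃ = −((1/2)q₁q₂ + q₃)∇E₁. (These are the relations ω₁x_i = ω₀x_{i+1} + F_iω₀x₁ with F₁ = −q₁, F₂ = −(1/4)q₁² − q₂, F₃ = −(1/2)q₁q₂ − q₃, since ω₀x_i = ∇E_i.) -/
noncomputable section Stmt13

/-- Gradient on `ℝ⁶`, coordinates `(q₁,q₂,q₃,p₁,p₂,p₃) = (x 0,…,x 5)`. -/
def grad (F : (Fin 6 → ℝ) → ℝ) (x : Fin 6 → ℝ) : Fin 6 → ℝ :=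
  fun i => pd i F x

/-- The canonical Poisson matrix `π₀ = [[0₃, I₃],[−I₃, 0₃]]`. -/
def pi0 : Matrix (Fin 6) (Fin 6) ℝ :=
  !![0,0,0,1,0,0; 0,0,0,0,1,0; 0,0,0,0,0,1;
     -1,0,0,0,0,0; 0,-1,0,0,0,0; 0,0,-1,0,0,0]

/-- The second (noncanonical) symplectic form of Example 1. -/
def omega1 (x : Fin 6 → ℝ) : Matrix (Fin 6) (Fin 6) ℝ :=
  !![0, (1/2) * x 4, (1/2) * x 5, (1/2) * x 0, (1/2) * x 1, x 2;
     -(1/2) * x 4, 0, 0, -1, 0, (1/2) * x 1;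
     -(1/2) * x 5, 0, 0, 0, -1, (1/2) * x 0;
     -(1/2) * x 0, 1, 0, 0, 0, 0;
     -(1/2) * x 1, 0, 1, 0, 0, 0;
     -x 2, -(1/2) * x 1, -(1/2) * x 0, 0, 0, 0]

lemma grad_E1 (x : Fin 6 → ℝ) : grad E1 x = ![0, 0, 0, x 5, x 4, x 3] := by
  have h : ∀ i : Fin 6, HasFDerivAt (fun y : Fin 6 → ℝ => y i)
      (ContinuousLinearMap.proj (R := ℝ) (φ := fun _ : Fin 6 => ℝ) i) x :=
    fun i => hasFDerivAt_apply i x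
  have H : HasFDerivAt E1 _ x := ((h 3).mul (h 5)).add (((h 4).pow 2).const_mul (1/2))
  ext i
  unfold grad pd
  rw [H.fderiv]
  fin_cases i <;> simp [Pi.single_apply]

lemma grad_E2 (x : Fin 6 → ℝ) : grad E2 x =
    ![(1/2) * x 4 ^ 2 + (1/2) * x 3 * x 5, -(1/2) * x 4 * x 5, -(1/2) * x 5 ^ 2,
      x 4 + (1/2) * x 0 * x 5, x 3 + x 0 * x 4 - (1/2) * x 1 * x 5,
      (1/2) * x 0 * x 3 - (1/2) * x 1 * x 4 - x 2 * x 5] := by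
  have h : ∀ i : Fin 6, HasFDerivAt (fun y : Fin 6 → ℝ => y i)
      (ContinuousLinearMap.proj (R := ℝ) (φ := fun _ : Fin 6 => ℝ) i) x :=
    fun i => hasFDerivAt_apply i x
  have H : HasFDerivAt E2 _ x :=
    (((((h 3).mul (h 4)).add (((h 0).const_mul (1/2)).mul ((h 4).pow 2))).add
      ((((h 0).const_mul (1/2)).mul (h 3)).mul (h 5))).sub
      ((((h 1).const_mul (1/2)).mul (h 4)).mul (h 5))).sub
      (((h 2).const_mul (1/2)).mul ((h 5).pow 2))
  ext i
  unfold grad pd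
  rw [H.fderiv]
  fin_cases i <;> simp [Pi.single_apply] <;> ring

lemma grad_E3 (x : Fin 6 → ℝ) : grad E3 x =
    ![(1/4) * x 0 * x 4 ^ 2 + (1/2) * x 3 * x 4 - (1/4) * x 1 * x 4 * x 5,
      (1/4) * x 1 * x 5 ^ 2 + (1/2) * x 3 * x 5 - (1/4) * x 0 * x 4 * x 5,
      - x 4 * x 5,
      x 3 + (1/2) * x 0 * x 4 + (1/2) * x 1 * x 5,
      (1/4) * x 0 ^ 2 * x 4 + (1/2) * x 0 * x 3 - ((1/4) * x 0 * x 1 + x 2) * x 5,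
      (1/4) * x 1 ^ 2 * x 5 + (1/2) * x 1 * x 3 - ((1/4) * x 0 * x 1 + x 2) * x 4] := by
  have h : ∀ i : Fin 6, HasFDerivAt (fun y : Fin 6 → ℝ => y i)
      (ContinuousLinearMap.proj (R := ℝ) (φ := fun _ : Fin 6 => ℝ) i) x :=
    fun i => hasFDerivAt_apply i x
  have H : HasFDerivAt E3 _ x :=
    (((((((h 3).pow 2).const_mul (1/2)).add
      ((((h 0).pow 2).const_mul (1/8)).mul ((h 4).pow 2))).add
      ((((h 1).pow 2).const_mul (1/8)).mul ((h 5).pow 2))).add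
      ((((h 0).const_mul (1/2)).mul (h 3)).mul (h 4))).add
      ((((h 1).const_mul (1/2)).mul (h 3)).mul (h 5))).sub
      ((((((h 0).const_mul (1/4)).mul (h 1)).add (h 2)).mul (h 4)).mul (h 5))
  ext i
  unfold grad pd
  rw [H.fderiv]
  fin_cases i <;> simp [Pi.single_apply] <;> ring

/-- Example 1: quasi-bi-inverse-Hamiltonian chain
`ω₁xᵢ = ω₀x_{i+1} + Fᵢ ω₀x₁` with `xᵢ = π₀∇Eᵢ` and `ω₀xᵢ = ∇Eᵢ`. -/
theorem stmt13 : ∀ x : Fin 6 → ℝ,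
    (omega1 x).mulVec (pi0.mulVec (grad E1 x)) = grad E2 x - x 0 • grad E1 x ∧
    (omega1 x).mulVec (pi0.mulVec (grad E2 x)) =
      grad E3 x - ((1/4) * x 0 ^ 2 + x 1) • grad E1 x ∧
    (omega1 x).mulVec (pi0.mulVec (grad E3 x)) =
      -((1/2) * x 0 * x 1 + x 2) • grad E1 x := by
  intro x
  rw [grad_E1, grad_E2, grad_E3]
  refine ⟨?_, ?_, ?_⟩ <;> ext i <;> fin_cases i <;>
    simp [omega1, pi0, Matrix.mulVec, dotProduct, Fin.sum_univ_succ] <;> ring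

end Stmt13
end

section
/- (Example 1: bi-inverse-Hamiltonian chain on the extended phase space.) On ℝ⁷ with coordinates (q₁,q₂,q₃,p₁,p₂,p₃,c), let E₁, E₂, E₃ be the functions of (q,p) defined by E₁ = p₁p₃ + (1/2)p₂², E₂ = p₁p₂ + (1/2)q₁p₂² + (1/2)q₁p₁p₃ − (1/2)q₂p₂p₃ − (1/2)q₃p₃², E₃ = (1/2)p₁² + (1/8)q₁²p₂² + (1/8)q₂²p₃² + (1/2)q₁p₁p₂ + (1/2)q₂p₁p₃ − ((1/4)q₁q₂ + q₃)p₂p₃ (independent of c). Let Ω₀ be the 7×7 block matrix [[ω₀, 0],[0, 0]] and Ω₁ the 7×7 block matrix [[ω₁, ∇₆E₁],[−(∇₆E₁)ᵀ, 0]], where ω₀ = [[0₃,−I₃],[I₃,0₃]], ω₁ is the 6×6 matrix with rows (0, (1/2)p₂, (1/2)p₃, (1/2)q₁, (1/2)q₂, q₃), (−(1/2)p₂, 0, 0, −1, 0, (1/2)q₂), (−(1/2)p₃, 0, 0, 0, −1, (1/2)q₁), (−(1/2)q₁, 1, 0, 0, 0, 0), (−(1/2)q₂, 0, 1, 0, 0,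 0), (−q₃, −(1/2)q₂, −(1/2)q₁, 0, 0, 0), and ∇₆E₁ is the 6-dimensional gradient of E₁ in (q,p). Set Y₀ := e₇ (the unit vector in the c-direction), X_i := (π₀∇₆E_i, 0) ∈ ℝ⁷, F₁ := −q₁, F₂ := −(1/4)q₁² − q₂, F₃ := −(1/2)q₁q₂ − q₃, and Y_i := X_i − F_i·e₇ for i = 1,2,3. Then at every point of ℝ⁷: Ω₀Y₀ = 0, Ω₀Y_i = ∇₇E_i for i = 1,2,3, Ω₁Y₀ = ∇₇E₁, Ω₁Y₁ = ∇₇E₂, Ω₁Y₂ = ∇₇E₃, and Ω₁Y₃ = 0, where ∇₇ is the full 7-dimensional gradient. -/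
noncomputable section Stmt14

/-- Partial derivative on `ℝ⁶`. -/
def pd6 (i : Fin 6) (F : (Fin 6 → ℝ) → ℝ) (x : Fin 6 → ℝ) : ℝ :=
  fderiv ℝ F x (Pi.single i 1)

/-- Gradient on `ℝ⁶`, coordinates `(q₁,q₂,q₃,p₁,p₂,p₃) = (x 0,…,x 5)`. -/
def grad6 (F : (Fin 6 → ℝ) → ℝ) (x : Fin 6 → ℝ) : Fin 6 → ℝ :=
  fun i => pd6 i F x

/-- Partial derivative on the extended space `ℝ⁷` (extra coordinate `c = x 6`). -/
def pd7 (i : Fin 7) (F : (Fin 7 → ℝ) → ℝ) (x : Fin 7 → ℝ) : ℝ :=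
  fderiv ℝ F x (Pi.single i 1)

/-- Gradient on `ℝ⁷`. -/
def grad7 (F : (Fin 7 → ℝ) → ℝ) (x : Fin 7 → ℝ) : Fin 7 → ℝ :=
  fun i => pd7 i F x

/-- `E₁, E₂, E₃` regarded as functions on `ℝ⁷`, constant in `c`. -/
def E1e (x : Fin 7 → ℝ) : ℝ := E1 (Fin.init x)
def E2e (x : Fin 7 → ℝ) : ℝ := E2 (Fin.init x)
def E3e (x : Fin 7 → ℝ) : ℝ := E3 (Fin.init x)

/-- The presymplectic form `Ω₀ = [[ω₀, 0],[0, 0]]` on `ℝ⁷`,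
where `ω₀ = [[0₃, −I₃],[I₃, 0₃]]`. -/
def Omega0 : Matrix (Fin 7) (Fin 7) ℝ :=
  !![0,0,0,-1,0,0,0; 0,0,0,0,-1,0,0; 0,0,0,0,0,-1,0;
     1,0,0,0,0,0,0; 0,1,0,0,0,0,0; 0,0,1,0,0,0,0;
     0,0,0,0,0,0,0]

/-- The presymplectic form `Ω₁ = [[ω₁, ∇₆E₁],[−(∇₆E₁)ᵀ, 0]]` on `ℝ⁷`. -/
def Omega1 (x : Fin 7 → ℝ) : Matrix (Fin 7) (Fin 7) ℝ :=
  Matrix.reindex finSumFinEquiv finSumFinEquiv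
    (Matrix.fromBlocks (omega1 (Fin.init x))
      (Matrix.of fun i (_ : Fin 1) => grad6 E1 (Fin.init x) i)
      (Matrix.of fun (_ : Fin 1) j => - grad6 E1 (Fin.init x) j) 0)

/-- The kernel vector `Y₀ = e₇` in the `c`-direction. -/
def Y0 : Fin 7 → ℝ := Pi.single (6 : Fin 7) 1

/-- The lifted Hamiltonian vector fields `Xᵢ = (π₀∇₆Eᵢ, 0)`. -/
def Xe (F : (Fin 6 → ℝ) → ℝ) (x : Fin 7 → ℝ) : Fin 7 → ℝ :=
  Fin.snoc (pi0.mulVec (grad6 F (Fin.init x))) 0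

def F1 (x : Fin 7 → ℝ) : ℝ := -x 0
def F2 (x : Fin 7 → ℝ) : ℝ := -(1/4) * x 0 ^ 2 - x 1
def F3 (x : Fin 7 → ℝ) : ℝ := -(1/2) * x 0 * x 1 - x 2

def Y1 (x : Fin 7 → ℝ) : Fin 7 → ℝ := Xe E1 x - F1 x • Y0
def Y2 (x : Fin 7 → ℝ) : Fin 7 → ℝ := Xe E2 x - F2 x • Y0
def Y3 (x : Fin 7 → ℝ) : Fin 7 → ℝ := Xe E3 x - F3 x • Y0

lemma fderiv_coord6 (i : Fin 6) (x v : Fin 6 → ℝ) :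
    fderiv ℝ (fun y : Fin 6 → ℝ => y i) x v = v i := by
  rw [(hasFDerivAt_apply i x).fderiv]; rfl

lemma diff_E1 : Differentiable ℝ E1 := by unfold E1; fun_prop
lemma diff_E2 : Differentiable ℝ E2 := by unfold E2; fun_prop
lemma diff_E3 : Differentiable ℝ E3 := by unfold E3; fun_prop

lemma grad6_E1 (x : Fin 6 → ℝ) : grad6 E1 x = ![0, 0, 0, x 5, x 4, x 3] := by
  funext i
  unfold grad6 pd6 E1
  simp (disch := fun_prop) only [fderiv_fun_add, fderiv_fun_sub, fderiv_fun_mul, fderiv_fun_pow,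
    fderiv_fun_const, add_apply, sub_apply, smul_apply, _root_.smul_apply, ContinuousLinearMap.add_apply,
    ContinuousLinearMap.sub_apply, ContinuousLinearMap.smul_apply, fderiv_coord6]
  fin_cases i <;> simp [Pi.single_apply]

lemma grad6_E2 (x : Fin 6 → ℝ) : grad6 E2 x =
    ![1/2 * x 4 ^ 2 + 1/2 * x 3 * x 5, -(1/2) * x 4 * x 5, -(1/2) * x 5 ^ 2,
      x 4 + 1/2 * x 0 * x 5, x 3 + x 0 * x 4 - 1/2 * x 1 * x 5,
      1/2 * x 0 * x 3 - 1/2 * x 1 * x 4 - x 2 * x 5] := by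
  funext i
  unfold grad6 pd6 E2
  simp (disch := fun_prop) only [fderiv_fun_add, fderiv_fun_sub, fderiv_fun_mul, fderiv_fun_pow,
    fderiv_fun_const, ContinuousLinearMap.add_apply,
    ContinuousLinearMap.sub_apply, ContinuousLinearMap.smul_apply, fderiv_coord6]
  fin_cases i <;> simp [Pi.single_apply] <;> ring

lemma grad6_E3 (x : Fin 6 → ℝ) : grad6 E3 x =
    ![1/4 * x 0 * x 4 ^ 2 + 1/2 * x 3 * x 4 - 1/4 * x 1 * x 4 * x 5,
      1/4 * x 1 * x 5 ^ 2 + 1/2 * x 3 * x 5 - 1/4 * x 0 * x 4 * x 5,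
      - x 4 * x 5,
      x 3 + 1/2 * x 0 * x 4 + 1/2 * x 1 * x 5,
      1/4 * x 0 ^ 2 * x 4 + 1/2 * x 0 * x 3 - (1/4 * x 0 * x 1 + x 2) * x 5,
      1/4 * x 1 ^ 2 * x 5 + 1/2 * x 1 * x 3 - (1/4 * x 0 * x 1 + x 2) * x 4] := by
  funext i
  unfold grad6 pd6 E3
  simp (disch := fun_prop) only [fderiv_fun_add, fderiv_fun_sub, fderiv_fun_mul, fderiv_fun_pow,
    fderiv_fun_const, ContinuousLinearMap.add_apply,
    ContinuousLinearMap.sub_apply, ContinuousLinearMap.smul_apply, fderiv_coord6]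
  fin_cases i <;> simp [Pi.single_apply] <;> ring

/-- Forgetting the last coordinate, as a continuous linear map. -/
def initL : (Fin 7 → ℝ) →L[ℝ] (Fin 6 → ℝ) :=
  ContinuousLinearMap.pi fun i : Fin 6 => ContinuousLinearMap.proj i.castSucc

lemma grad7_init (F : (Fin 6 → ℝ) → ℝ) (hF : Differentiable ℝ F) (x : Fin 7 → ℝ) :
    grad7 (fun y => F (Fin.init y)) x = Fin.snoc (grad6 F (Fin.init x)) 0 := by
  have h : HasFDerivAt (fun y : Fin 7 → ℝ => F (Fin.init y))
      ((fderiv ℝ F (Fin.init x)).comp initL) x :=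
    HasFDerivAt.comp (f := fun y : Fin 7 → ℝ => (Fin.init y : Fin 6 → ℝ)) x
      (hF (Fin.init x)).hasFDerivAt (initL.hasFDerivAt (x := x))
  funext i
  unfold grad7 pd7
  rw [h.fderiv, ContinuousLinearMap.comp_apply]
  refine Fin.lastCases ?_ (fun j => ?_) i
  · have : initL (Pi.single (Fin.last 6) 1) = 0 := by
      funext k
      exact Pi.single_eq_of_ne (Fin.castSucc_lt_last k).ne 1
    rw [this, map_zero, Fin.snoc_last]
  · have : initL (Pi.single j.castSucc 1) = Pi.single j 1 := by
      funext k
      show (Pi.single j.castSucc (1 : ℝ) : Fin 7 → ℝ) k.castSucc = _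
      simp [Pi.single_apply]
    rw [this, Fin.snoc_castSucc]
    rfl

lemma snoc_vec6 (a b c d e f g : ℝ) :
    (Fin.snoc (α := fun _ => ℝ) ![a, b, c, d, e, f] g : Fin 7 → ℝ) = ![a, b, c, d, e, f, g] := by
  funext i
  fin_cases i <;> rfl

lemma Y0_eq : Y0 = ![0, 0, 0, 0, 0, 0, 1] := by
  funext i
  fin_cases i <;> simp [Y0, Pi.single_apply]

lemma pi0_mulVec (a b c d e f : ℝ) :
    pi0.mulVec ![a, b, c, d, e, f] = ![d, e, f, -a, -b, -c] := by
  funext i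
  fin_cases i <;> simp [pi0, Matrix.mulVec, dotProduct, Fin.sum_univ_succ]

lemma Omega0_mulVec (a b c d e f g : ℝ) :
    Omega0.mulVec ![a, b, c, d, e, f, g] = ![-d, -e, -f, a, b, c, 0] := by
  funext i
  fin_cases i <;> simp [Omega0, Matrix.mulVec, dotProduct, Fin.sum_univ_succ]

lemma Omega1_eq (x : Fin 7 → ℝ) : Omega1 x =
    !![0, (1/2) * x 4, (1/2) * x 5, (1/2) * x 0, (1/2) * x 1, x 2, 0;
     -(1/2) * x 4, 0, 0, -1, 0, (1/2) * x 1, 0;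
     -(1/2) * x 5, 0, 0, 0, -1, (1/2) * x 0, 0;
     -(1/2) * x 0, 1, 0, 0, 0, 0, x 5;
     -(1/2) * x 1, 0, 1, 0, 0, 0, x 4;
     -x 2, -(1/2) * x 1, -(1/2) * x 0, 0, 0, 0, x 3;
     -0, -0, -0, -x 5, -x 4, -x 3, 0] := by
  unfold Omega1
  rw [grad6_E1]
  ext i j
  fin_cases i <;> fin_cases j <;> rfl

lemma Omega1_mulVec (x : Fin 7 → ℝ) (a b c d e f g : ℝ) :
    (Omega1 x).mulVec ![a, b, c, d, e, f, g] =
    ![(1/2) * x 4 * b + (1/2) * x 5 * c + (1/2) * x 0 * d + (1/2) * x 1 * e + x 2 * f,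
      -(1/2) * x 4 * a - d + (1/2) * x 1 * f,
      -(1/2) * x 5 * a - e + (1/2) * x 0 * f,
      -(1/2) * x 0 * a + b + x 5 * g,
      -(1/2) * x 1 * a + c + x 4 * g,
      -x 2 * a - (1/2) * x 1 * b - (1/2) * x 0 * c + x 3 * g,
      -x 5 * d - x 4 * e - x 3 * f] := by
  rw [Omega1_eq]
  funext i
  fin_cases i <;> simp [Matrix.mulVec, dotProduct, Fin.sum_univ_succ] <;> ring

lemma init_coord (x : Fin 7 → ℝ) :
    (Fin.init x : Fin 6 → ℝ) = ![x 0, x 1, x 2, x 3, x 4, x 5] := by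
  funext i
  fin_cases i <;> rfl

lemma sub_smul_vec (a b c d e f r : ℝ) :
    ![a, b, c, d, e, f, 0] - r • ![0, 0, 0, 0, 0, 0, 1] = ![a, b, c, d, e, f, -r] := by
  funext i
  fin_cases i <;> simp

/-- Example 1: bi-inverse-Hamiltonian chain on the extended phase space `ℝ⁷`. -/
theorem stmt14 : ∀ x : Fin 7 → ℝ,
    Omega0.mulVec Y0 = 0 ∧
    Omega0.mulVec (Y1 x) = grad7 E1e x ∧
    Omega0.mulVec (Y2 x) = grad7 E2e x ∧
    Omega0.mulVec (Y3 x) = grad7 E3e x ∧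
    (Omega1 x).mulVec Y0 = grad7 E1e x ∧
    (Omega1 x).mulVec (Y1 x) = grad7 E2e x ∧
    (Omega1 x).mulVec (Y2 x) = grad7 E3e x ∧
    (Omega1 x).mulVec (Y3 x) = 0 := by
  intro x
  have g1 := grad7_init E1 diff_E1 x
  have g2 := grad7_init E2 diff_E2 x
  have g3 := grad7_init E3 diff_E3 x
  change grad7 E1e x = _ at g1
  change grad7 E2e x = _ at g2
  change grad7 E3e x = _ at g3
  rw [grad6_E1, snoc_vec6] at g1
  rw [grad6_E2, snoc_vec6] at g2
  rw [grad6_E3, snoc_vec6] at g3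
  rw [g1, g2, g3]
  unfold Y1 Y2 Y3 Xe
  rw [grad6_E1, grad6_E2, grad6_E3, Y0_eq]
  simp only [pi0_mulVec, snoc_vec6, sub_smul_vec, Omega0_mulVec, Omega1_mulVec, init_coord]
  refine ⟨?_, ?_, ?_, ?_, ?_, ?_, ?_, ?_⟩ <;> funext i <;> fin_cases i <;>
    simp [F1, F2, F3] <;> ring

end Stmt14
end

section
/- (Example 2: quasi-bi-inverse-Hamiltonian chains of co-rank two.) On the open subset of ℝ⁶ where σ₂ := (1/4)q₁² + q₂ ≠ 0, with σ₁ := q₁, σ₃ := (1/2)q₁q₂ + q₃, with E₁, E₂, E₃ as in Example 1, and with h₁^{(1)} := −E₂/σ₂, h₂^{(1)} := E₁ − (σ₁/σ₂)E₂, h₁^{(2)} := E₃ − (σ₃/σ₂)E₂, let x_i^{(k)} := π₀∇h_i^{(k)} and let ω₁ be the 6×6 matrix with rows (0, (1/2)p₂, (1/2)p₃, (1/2)q₁, (1/2)q₂, q₃), (−(1/2)p₂, 0, 0, −1, 0, (1/2)q₂), (−(1/2)p₃, 0, 0, 0, −1, (1/2)q₁), (−(1/2)q₁, 1, 0, 0,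 0, 0), (−(1/2)q₂, 0, 1, 0, 0, 0), (−q₃, −(1/2)q₂, −(1/2)q₁, 0, 0, 0). Then at every point of this open set: ω₁x₁^{(1)} = ∇h₂^{(1)} + (−σ₁ + σ₃/σ₂)∇h₁^{(1)} + (−1/σ₂)∇h₁^{(2)}; ω₁x₂^{(1)} = (−σ₂ + σ₁σ₃/σ₂)∇h₁^{(1)} + (−σ₁/σ₂)∇h₁^{(2)}; ω₁x₁^{(2)} = (σ₃²/σ₂)∇h₁^{(1)} + (−σ₃/σ₂)∇h₁^{(2)}. (These are the relations ω₁x_i^{(k)} = ω₀x_{i+1}^{(k)} + Σ_l F_i^{(k,l)}ω₀x₁^{(l)} with F₁^{(1,1)} = −σ₁ + σ₃/σ₂, F₂^{(1,1)} = −σ₂ + σ₁σ₃/σ₂, F₁^{(2,1)} = σ₃²/σ₂, F₁^{(1,2)} = −1/σ₂, F₂^{(1,2)} = −σ₁/σ₂, F₁^{(2,2)} = −σ₃/σ₂, since ω₀x_i^{(k)} = ∇h_i^{(k)}.) -/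
noncomputable section Stmt16

def sigma1 (x : Fin 6 → ℝ) : ℝ := x 0
def sigma2 (x : Fin 6 → ℝ) : ℝ := (1/4) * x 0 ^ 2 + x 1
def sigma3 (x : Fin 6 → ℝ) : ℝ := (1/2) * x 0 * x 1 + x 2

def h11 (x : Fin 6 → ℝ) : ℝ := -(E2 x) / sigma2 x
def h21 (x : Fin 6 → ℝ) : ℝ := E1 x - (sigma1 x / sigma2 x) * E2 x
def h12 (x : Fin 6 → ℝ) : ℝ := E3 x - (sigma3 x / sigma2 x) * E2 x

/-- `F` is differentiable at `x` with gradient `g`. -/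
def HasG (F : (Fin 6 → ℝ) → ℝ) (x g : Fin 6 → ℝ) : Prop :=
  ∃ L : (Fin 6 → ℝ) →L[ℝ] ℝ, HasFDerivAt F L x ∧ ∀ i, L (Pi.single i 1) = g i

theorem HasG.grad_eq {F : (Fin 6 → ℝ) → ℝ} {x g : Fin 6 → ℝ} (h : HasG F x g) : grad F x = g := by
  obtain ⟨L, hL, h⟩ := h
  funext i
  simp only [grad, pd, hL.fderiv, h]

theorem HasG.congr {F F' : (Fin 6 → ℝ) → ℝ} {x g g' : Fin 6 → ℝ} (h : HasG F x g)
    (hF : ∀ y, F' y = F y) (hg : ∀ i, g i = g' i) : HasG F' x g' := by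
  obtain rfl : F' = F := funext hF
  obtain rfl : g = g' := funext hg
  exact h

theorem HasG.const (c : ℝ) (x : Fin 6 → ℝ) : HasG (fun _ => c) x 0 :=
  ⟨0, hasFDerivAt_const c x, fun i => by simp⟩

theorem HasG.coord (k : Fin 6) (x : Fin 6 → ℝ) : HasG (fun y => y k) x (Pi.single k 1) :=
  ⟨ContinuousLinearMap.proj k, hasFDerivAt_apply k x, fun i => by
    simp [Pi.single_apply, eq_comm]⟩

theorem HasG.add {F G : (Fin 6 → ℝ) → ℝ} {x f g : Fin 6 → ℝ} (hF : HasG F x f) (hG : HasG G x g) :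
    HasG (fun y => F y + G y) x (f + g) := by
  obtain ⟨L, hL, h⟩ := hF
  obtain ⟨M, hM, h'⟩ := hG
  exact ⟨_, hL.add hM, fun i => by simp [h, h']⟩

theorem HasG.sub {F G : (Fin 6 → ℝ) → ℝ} {x f g : Fin 6 → ℝ} (hF : HasG F x f) (hG : HasG G x g) :
    HasG (fun y => F y - G y) x (f - g) := by
  obtain ⟨L, hL, h⟩ := hF
  obtain ⟨M, hM, h'⟩ := hG
  exact ⟨_, hL.sub hM, fun i => by simp [h, h']⟩

theorem HasG.mul {F G : (Fin 6 → ℝ) → ℝ} {x f g : Fin 6 → ℝ} (hF : HasG F x f) (hG : HasG G x g) :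
    HasG (fun y => F y * G y) x (F x • g + G x • f) := by
  obtain ⟨L, hL, h⟩ := hF
  obtain ⟨M, hM, h'⟩ := hG
  exact ⟨_, hL.mul hM, fun i => by simp [h, h']⟩

theorem HasG.inv {F : (Fin 6 → ℝ) → ℝ} {x f : Fin 6 → ℝ} (hF : HasG F x f) (h0 : F x ≠ 0) :
    HasG (fun y => (F y)⁻¹) x (-((F x)⁻¹ ^ 2) • f) := by
  obtain ⟨L, hL, h⟩ := hF
  exact ⟨_, (hasDerivAt_inv h0).comp_hasFDerivAt x hL, fun i => by simp [h]⟩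

theorem hasG_sigma1 (x : Fin 6 → ℝ) : HasG sigma1 x ![1, 0, 0, 0, 0, 0] :=
  (HasG.coord 0 x).congr (fun y => rfl) (fun i => by fin_cases i <;> simp)

theorem hasG_sigma2 (x : Fin 6 → ℝ) : HasG sigma2 x ![(1/2) * x 0, 1, 0, 0, 0, 0] := by
  have X := fun k => HasG.coord k x
  have C := fun c => HasG.const c x
  refine (((C (1/4)).mul ((X 0).mul (X 0))).add (X 1)).congr
    (fun y => by simp only [sigma2]; ring) (fun i => ?_)
  fin_cases i <;> simp <;> ring

theorem hasG_sigma3 (x : Fin 6 → ℝ) :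
    HasG sigma3 x ![(1/2) * x 1, (1/2) * x 0, 1, 0, 0, 0] := by
  have X := fun k => HasG.coord k x
  have C := fun c => HasG.const c x
  refine (((C (1/2)).mul ((X 0).mul (X 1))).add (X 2)).congr
    (fun y => by simp only [sigma3]; ring) (fun i => ?_)
  fin_cases i <;> simp

theorem hasG_E1 (x : Fin 6 → ℝ) : HasG E1 x ![0, 0, 0, x 5, x 4, x 3] := by
  have X := fun k => HasG.coord k x
  have C := fun c => HasG.const c x
  refine (((X 3).mul (X 5)).add ((C (1/2)).mul ((X 4).mul (X 4)))).congr
    (fun y => by simp only [E1]; ring) (fun i => ?_)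
  fin_cases i <;> simp <;> ring

theorem hasG_E2 (x : Fin 6 → ℝ) : HasG E2 x
    ![(1/2) * x 4 ^ 2 + (1/2) * x 3 * x 5, -(1/2) * x 4 * x 5, -(1/2) * x 5 ^ 2,
      x 4 + (1/2) * x 0 * x 5, x 3 + x 0 * x 4 - (1/2) * x 1 * x 5,
      (1/2) * x 0 * x 3 - (1/2) * x 1 * x 4 - x 2 * x 5] := by
  have X := fun k => HasG.coord k x
  have C := fun c => HasG.const c x
  refine (((X 3).mul (X 4)).add ((C (1/2)).mul
    (((((X 0).mul ((X 4).mul (X 4))).add ((X 0).mul ((X 3).mul (X 5)))).sub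
      ((X 1).mul ((X 4).mul (X 5)))).sub ((X 2).mul ((X 5).mul (X 5)))))).congr
    (fun y => by simp only [E2]; ring) (fun i => ?_)
  fin_cases i <;> simp <;> ring

theorem hasG_E3 (x : Fin 6 → ℝ) : HasG E3 x
    ![(1/4) * x 0 * x 4 ^ 2 + (1/2) * x 3 * x 4 - (1/4) * x 1 * x 4 * x 5,
      (1/4) * x 1 * x 5 ^ 2 + (1/2) * x 3 * x 5 - (1/4) * x 0 * x 4 * x 5,
      - x 4 * x 5,
      x 3 + (1/2) * x 0 * x 4 + (1/2) * x 1 * x 5,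
      (1/4) * x 0 ^ 2 * x 4 + (1/2) * x 0 * x 3 - ((1/4) * x 0 * x 1 + x 2) * x 5,
      (1/4) * x 1 ^ 2 * x 5 + (1/2) * x 1 * x 3 - ((1/4) * x 0 * x 1 + x 2) * x 4] := by
  have X := fun k => HasG.coord k x
  have C := fun c => HasG.const c x
  have A := (X 0).mul (X 4)
  have B := (X 1).mul (X 5)
  have D := (X 4).mul (X 5)
  refine (((((((C (1/2)).mul ((X 3).mul (X 3))).add ((C (1/8)).mul (A.mul A))).add
    ((C (1/8)).mul (B.mul B))).add ((C (1/2)).mul (A.mul (X 3)))).add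
    ((C (1/2)).mul (B.mul (X 3)))).sub
    ((((C (1/4)).mul ((X 0).mul (X 1))).add (X 2)).mul D)).congr
    (fun y => by simp only [E3]; ring) (fun i => ?_)
  fin_cases i <;> simp <;> ring

set_option maxHeartbeats 4000000 in
/-- Example 2: quasi-bi-inverse-Hamiltonian chains of co-rank two:
`ω₁xᵢ⁽ᵏ⁾ = ω₀x_{i+1}⁽ᵏ⁾ + Σ_l Fᵢ^{(k,l)} ω₀x₁⁽ˡ⁾` with `xᵢ⁽ᵏ⁾ = π₀∇hᵢ⁽ᵏ⁾`. -/
theorem stmt16 : ∀ x : Fin 6 → ℝ, sigma2 x ≠ 0 →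
    (omega1 x).mulVec (pi0.mulVec (grad h11 x)) =
      grad h21 x + (-sigma1 x + sigma3 x / sigma2 x) • grad h11 x
        + (-1 / sigma2 x) • grad h12 x ∧
    (omega1 x).mulVec (pi0.mulVec (grad h21 x)) =
      (-sigma2 x + sigma1 x * sigma3 x / sigma2 x) • grad h11 x
        + (-sigma1 x / sigma2 x) • grad h12 x ∧
    (omega1 x).mulVec (pi0.mulVec (grad h12 x)) =
      (sigma3 x ^ 2 / sigma2 x) • grad h11 x
        + (-sigma3 x / sigma2 x) • grad h12 x := by
  intro x hx
  have hi := (hasG_sigma2 x).inv hx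
  have g11 := (((HasG.const (-1) x).mul ((hasG_E2 x).mul hi)).congr (F' := h11)
    (fun y => by simp only [h11]; ring) (fun i => rfl)).grad_eq
  have g21 := (((hasG_E1 x).sub (((hasG_sigma1 x).mul hi).mul (hasG_E2 x))).congr (F' := h21)
    (fun y => by simp only [h21]; ring) (fun i => rfl)).grad_eq
  have g12 := (((hasG_E3 x).sub (((hasG_sigma3 x).mul hi).mul (hasG_E2 x))).congr (F' := h12)
    (fun y => by simp only [h12]; ring) (fun i => rfl)).grad_eq
  rw [g11, g21, g12]
  have hx1 : x 1 = sigma2 x - (1/4) * x 0 ^ 2 := by simp only [sigma2]; ring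
  generalize sigma2 x = s at *
  simp only [sigma1, sigma3, E2]
  refine ⟨?_, ?_, ?_⟩ <;> funext i <;> fin_cases i <;>
    simp [omega1, pi0, Matrix.mulVec, dotProduct, Fin.sum_univ_six] <;>
    rw [hx1] <;> field_simp <;> ring

end Stmt16
end
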